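/- Let n ≥ 2, a_0, …, a_n real, a ∈ (−1,1), 0 < r ≤ 1/2, and suppose 1/(2·√(1−a²)) ≤ n < √(1−a²)/(2r). Let u_k(a) be the Clenshaw sequence of p at a, and let M > 0 satisfy |u_k(a)| ≤ M for 1 ≤ k ≤ n. Define e_n = 0, f_n = 0; for k = n−1 down to 1: f_k = 2r·|u_{k+1}(a)| + 2r·e_{k+1} + f_{k+1} and e_k = min(e_{k+1} + f_k, f_k/√(1−a²)); finally f_0 = r·|u_1(a)| + 2r·e_1 + f_1 and e_0 = min(e_1 + f_0, f_0/√(1−a²)). Then e_0 ≤ 9Mnr/√(1−a²). -/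

import Mathlib

open Finset

/-- Discrete Gronwall bound: if `f k ≤ b + (1 + q) f (k + 1)` for `k < n`, `f n = 0` and `q n ≤ 1`,
then `f (n - j)` grows at most quadratically in `j`. -/
theorem backward_recurrence_le {n : ℕ} {f : ℕ → ℝ} {b q : ℝ} (hb : 0 ≤ b) (hq : 0 ≤ q)
    (hqn : q * n ≤ 1) (hfn : f n = 0) (hf : ∀ k < n, f k ≤ b + (1 + q) * f (k + 1))
    (j : ℕ) (hj : j ≤ n) : f (n - j) ≤ b * (j + q * (j : ℝ) ^ 2) := by
  induction j with
  | zero => simp [hfn]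
  | succ j ih =>
    have hstep := hf (n - (j + 1)) (by omega)
    rw [show n - (j + 1) + 1 = n - j by omega] at hstep
    have hqj : q * j ≤ 1 :=
      (mul_le_mul_of_nonneg_left (Nat.cast_le.mpr (by omega)) hq).trans hqn
    have hj0 : (0 : ℝ) ≤ j := j.cast_nonneg
    calc f (n - (j + 1)) ≤ b + (1 + q) * f (n - j) := hstep
      _ ≤ b + (1 + q) * (b * (j + q * (j : ℝ) ^ 2)) := by
        gcongr
        exact ih (by omega)
      _ = b * (1 + j + q * (j ^ 2 + j + j * (q * j))) := by ring
      _ ≤ b * (1 + j + q * (j ^ 2 + j + (j + 1))) := by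
        gcongr b * (1 + j + q * (j ^ 2 + j + ?_))
        linarith [mul_le_mul_of_nonneg_left hqj hj0]
      _ = b * ((j + 1 : ℕ) + q * ((j + 1 : ℕ) : ℝ) ^ 2) := by push_cast; ring

/-- Radius bound for the ball Clenshaw algorithm (forward error, exact arithmetic),
case `1/(2√(1-a²)) ≤ n < √(1-a²)/(2r)`: the final radius satisfies `e₀ ≤ 9Mnr/√(1-a²)`. -/
theorem ball_clenshaw_forward_radius_medium_n (n : ℕ) (hn : 2 ≤ n) (a : ℕ → ℝ)
    (c : ℝ) (hc : c ∈ Set.Ioo (-1 : ℝ) 1) (r : ℝ) (hr : 0 < r)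
    (hr2 : r ≤ 1 / 2)
    (hncase₁ : 1 / (2 * Real.sqrt (1 - c ^ 2)) ≤ (n : ℝ))
    (hncase₂ : (n : ℝ) < Real.sqrt (1 - c ^ 2) / (2 * r))
    (u : ℕ → ℝ) (hun1 : u (n + 1) = 0) (hun : u n = a n)
    (hurec : ∀ k, 1 ≤ k → k ≤ n - 1 → u k = 2 * c * u (k + 1) - u (k + 2) + a k)
    (M : ℝ) (hM : 0 < M) (hMu : ∀ k, 1 ≤ k → k ≤ n → |u k| ≤ M)
    (e f : ℕ → ℝ) (hen : e n = 0) (hfn : f n = 0)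
    (href : ∀ k, 1 ≤ k → k ≤ n - 1 →
      f k = 2 * r * |u (k + 1)| + 2 * r * e (k + 1) + f (k + 1) ∧
      e k = min (e (k + 1) + f k) (f k / Real.sqrt (1 - c ^ 2)))
    (hf0 : f 0 = r * |u 1| + 2 * r * e 1 + f 1)
    (he0 : e 0 = min (e 1 + f 0) (f 0 / Real.sqrt (1 - c ^ 2))) :
    e 0 ≤ 9 * M * (n : ℝ) * r / Real.sqrt (1 - c ^ 2) := by
  set s := Real.sqrt (1 - c ^ 2) with hs
  have hs0 : 0 < s := Real.sqrt_pos.mpr (by nlinarith [hc.1, hc.2])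
  have hn0 : (0 : ℝ) < n := by exact_mod_cast (by omega : 0 < n)
  have he : ∀ k, 1 ≤ k → k ≤ n → e k ≤ f k / s := fun k hk hkn => by
    rcases hkn.eq_or_lt with rfl | hlt
    · simp [hen, hfn]
    · rw [(href k hk (by omega)).2]
      exact min_le_right _ _
  have hf : ∀ k < n, f k ≤ 2 * r * M + (1 + 2 * r / s) * f (k + 1) := fun k hk => by
    have hu := mul_le_mul_of_nonneg_left (hMu (k + 1) (by omega) (by omega)) hr.le
    have hek := mul_le_mul_of_nonneg_left (he (k + 1) (by omega) (by omega)) hr.le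
    have hfk : f k ≤ 2 * r * |u (k + 1)| + 2 * r * e (k + 1) + f (k + 1) := by
      rcases Nat.eq_zero_or_pos k with rfl | hpos
      · rw [hf0]
        nlinarith [mul_nonneg hr.le (abs_nonneg (u 1))]
      · exact (href k hpos (by omega)).1.le
    have hring : (1 + 2 * r / s) * f (k + 1) = f (k + 1) + 2 * (r * (f (k + 1) / s)) := by ring
    linarith
  have hqn : 2 * r / s * n ≤ 1 := by
    rw [lt_div_iff₀ (by positivity)] at hncase₂
    rw [div_mul_eq_mul_div, div_le_one hs0]
    linarith
  have hbound := backward_recurrence_le (by positivity) (by positivity) hqn hfn hf n le_rfl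
  rw [Nat.sub_self] at hbound
  have hrMn : 0 < r * M * n := by positivity
  have hf0_le : f 0 ≤ 9 * M * n * r := by
    nlinarith [mul_le_mul_of_nonneg_left hqn hrMn.le]
  calc e 0 ≤ f 0 / s := he0.trans_le (min_le_right _ _)
    _ ≤ 9 * M * n * r / s := by gcongr
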